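/- arXiv:1410.0105 — 3 statements merged into one kernel-verified Lean document; each statement's English description precedes it below -/
import Mathlib

section
/- Let f, g ∈ R be nonzero, (u, f), (v, g) ∈ M, and let m be a monomial divisible by both lm(f) and lm(g). Set t_f = m/lm(f) and t_g = m/lm(g), and suppose t_f·lm(u) ≻_s t_g·lm(v). Let p = lc(g)·t_f·f − lc(f)·t_g·g and w = lc(g)·t_f·u − lc(f)·t_g·v. Then lm(w) = t_f·lm(u), the pair (w, p) belongs to M, lm(p) ≺_p m, and (lm(p), (w, p)) is a labeled monomial that is primitive if p ≠ 0 and a syzygy labeled monomial if p = 0. -/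
/- Common setup: monomials, leading monomials with the `lm 0 = 0` convention
   (encoded via `Option`, `none` being the zero monomial), module monomials
   (signatures), the module `M = {(u, h) | u ⬝ f = h}`, labeled monomials,
   cover, reducibility, etc., following the paper's conventions. -/

open MvPolynomial

noncomputable section GVW

variable {k : Type*} [Field k] {n l : ℕ}

/-- Leading exponent of a multivariate polynomial w.r.t. a monomial order
(`0` for the zero polynomial). -/
noncomputable def mdeg (m : MonomialOrder (Fin n)) (f : MvPolynomial (Fin n) k) : Fin n →₀ ℕ :=
  m.toSyn.symm (f.support.sup m.toSyn)

/-- Leading coefficient. -/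
noncomputable def mlc (m : MonomialOrder (Fin n)) (f : MvPolynomial (Fin n) k) : k :=
  f.coeff (mdeg m f)

/-- The leading monomial of `f`, with `lm 0 = 0` encoded as `none`. -/
noncomputable def lmo (m : MonomialOrder (Fin n)) (f : MvPolynomial (Fin n) k) :
    Option (Fin n →₀ ℕ) :=
  letI := Classical.dec (f = 0)
  if f = 0 then none else some (mdeg m f)

/-- Strict comparison `≺ₚ` of monomials-with-zero: the zero monomial is smallest. -/
def OMonLT (m : MonomialOrder (Fin n)) : Option (Fin n →₀ ℕ) → Option (Fin n →₀ ℕ) → Prop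
  | none, none => False
  | none, some _ => True
  | some _, none => False
  | some a, some b => m.toSyn a < m.toSyn b

/-- Divisibility of monomials-with-zero (polynomial convention: everything divides `0`,
`0` divides only `0`). -/
def OMonDvd : Option (Fin n →₀ ℕ) → Option (Fin n →₀ ℕ) → Prop
  | none, b => b = none
  | some _, none => True
  | some a, some b => a ≤ b

/-- The quotient `m / m'` of monomials-with-zero (junk value `0` if not both nonzero). -/
def oquot : Option (Fin n →₀ ℕ) → Option (Fin n →₀ ℕ) → (Fin n →₀ ℕ)
  | some a, some b => a - b
  | _, _ => 0

/-- Product of a monomial with a monomial-with-zero. -/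
def omul (t : Fin n →₀ ℕ) : Option (Fin n →₀ ℕ) → Option (Fin n →₀ ℕ) :=
  Option.map (fun a => t + a)

/-- A module monomial `x^α e_i` of `R^l`, as the pair `(α, i)`. -/
abbrev ModMon (n l : ℕ) := (Fin n →₀ ℕ) × Fin l

/-- The position-over-term extension `≺ₛ` of `≺ₚ` :
`x^α e_i ≺ₛ x^β e_j` iff `i > j`, or `i = j` and `α ≺ₚ β`. -/
def SigLT (m : MonomialOrder (Fin n)) (s t : ModMon n l) : Prop :=
  t.2 < s.2 ∨ (s.2 = t.2 ∧ m.toSyn s.1 < m.toSyn t.1)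

/-- `≺ₛ` on module monomials-with-zero; the zero module monomial is smallest. -/
def OSigLT (m : MonomialOrder (Fin n)) : Option (ModMon n l) → Option (ModMon n l) → Prop
  | none, none => False
  | none, some _ => True
  | some _, none => False
  | some s, some t => SigLT m s t

/-- `⪯ₛ` on module monomials-with-zero. -/
def OSigLE (m : MonomialOrder (Fin n)) (s t : Option (ModMon n l)) : Prop :=
  OSigLT m s t ∨ s = t

/-- Divisibility of module monomials-with-zero: `x^β e_j` divides `x^α e_i`
iff `j = i` and `x^β` divides `x^α`. -/
def OSigDvd : Option (ModMon n l) → Option (ModMon n l) → Prop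
  | none, t => t = none
  | some _, none => True
  | some s, some t => s.2 = t.2 ∧ s.1 ≤ t.1

/-- Product of a monomial of `R` with a module monomial-with-zero. -/
def osmul (t : Fin n →₀ ℕ) : Option (ModMon n l) → Option (ModMon n l) :=
  Option.map (fun s => (t + s.1, s.2))

/-- Quotient of module monomials-with-zero, a monomial of `R` (junk value `0` otherwise). -/
def sigquot : Option (ModMon n l) → Option (ModMon n l) → (Fin n →₀ ℕ)
  | some s, some t => s.1 - t.1
  | _, _ => 0

/-- The leading (module) monomial of a vector `u ∈ R^l`, w.r.t. the position-over-term
extension of the monomial order (`e_1 ≻ e_2 ≻ ⋯ ≻ e_l`); `none` for `u = 0`. -/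
noncomputable def vlmo (m : MonomialOrder (Fin n)) (u : Fin l → MvPolynomial (Fin n) k) :
    Option (ModMon n l) :=
  letI : DecidablePred fun i => u i ≠ 0 := Classical.decPred _
  if h : ∃ i, u i ≠ 0 then
    let i := (Finset.univ.filter fun i => u i ≠ 0).min'
      (by obtain ⟨i, hi⟩ := h; exact ⟨i, by simp [hi]⟩)
    some (mdeg m (u i), i)
  else none

/-- `(u, h)` belongs to the module `M`, i.e. `u ⬝ F = h`. -/
def InM (F : Fin l → MvPolynomial (Fin n) k) (u : Fin l → MvPolynomial (Fin n) k)
    (h : MvPolynomial (Fin n) k) : Prop :=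
  ∑ i, u i * F i = h

/-- The type of (potential) labeled monomials `(m, (u, h))`. -/
abbrev LMon (n l : ℕ) (k : Type*) [CommSemiring k] :=
  Option (Fin n →₀ ℕ) × (Fin l → MvPolynomial (Fin n) k) × MvPolynomial (Fin n) k

/-- `(m, (u, h))` is a labeled monomial w.r.t. `I = ⟨F⟩`:
`(u,h) ∈ M \ {(0,0)}` and `lm h` divides `m`. -/
def IsLabeled (m : MonomialOrder (Fin n)) (F : Fin l → MvPolynomial (Fin n) k)
    (x : LMon n l k) : Prop :=
  InM F x.2.1 x.2.2 ∧ ¬(x.2.1 = 0 ∧ x.2.2 = 0) ∧ OMonDvd (lmo m x.2.2) x.1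

/-- A primitive labeled monomial: `m = lm h ≠ 0`. -/
def IsPrimitive (m : MonomialOrder (Fin n)) (x : LMon n l k) : Prop :=
  x.2.2 ≠ 0 ∧ x.1 = lmo m x.2.2

/-- A syzygy labeled monomial: `(0, (u, 0))`. -/
def IsSyzygy (x : LMon n l k) : Prop :=
  x.1 = none ∧ x.2.2 = 0

/-- The signature of a labeled monomial `(m,(u,h))`: `t·lm(u)` with `t = m / lm h`
(`t = 1` when `h = 0`, since then `oquot _ none = 0`). -/
noncomputable def lmSig (m : MonomialOrder (Fin n)) (x : LMon n l k) : Option (ModMon n l) :=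
  osmul (oquot x.1 (lmo m x.2.2)) (vlmo m x.2.1)

/-- The labeled monomial `(m,(u,h))` is covered by the set `G`:
there is `(m',(v,g)) ∈ G` with `lm v ∣ t·lm(u)` and `t'·lm(g) ≺ₚ m` strictly,
where `t = m / lm h` and `t' = (t·lm u)/lm v`. -/
def Covered (m : MonomialOrder (Fin n)) (x : LMon n l k) (G : Set (LMon n l k)) : Prop :=
  ∃ y ∈ G, OSigDvd (vlmo m y.2.1) (lmSig m x) ∧
    OMonLT m (omul (sigquot (lmSig m x) (vlmo m y.2.1)) (lmo m y.2.2)) x.1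

/-- `B` has no collisions: no two distinct labeled monomials in `B` have the same
nonzero monomial. -/
def NoCollisions (B : Set (LMon n l k)) : Prop :=
  ∀ x ∈ B, ∀ y ∈ B, x.1 = y.1 → x.1 ≠ none → x = y

/-- `(m,(u,f))` is reducible by `B` : `f ≠ 0` and there is `(m,(v,g)) ∈ B` with the same
monomial `m` and `t_g·lm(v) ≺ₛ t_f·lm(u)`. -/
def Reducible (m : MonomialOrder (Fin n)) (x : LMon n l k) (B : Set (LMon n l k)) : Prop :=
  x.2.2 ≠ 0 ∧ ∃ y ∈ B, y.1 = x.1 ∧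
    OSigLT m (osmul (oquot x.1 (lmo m y.2.2)) (vlmo m y.2.1)) (lmSig m x)

/-- The result of the one-step reduction of `(m,(u,f))` by `(m,(v,g))`:
with `p = lc(g)·t_f·f − lc(f)·t_g·g`, it is
`(lm p, (lc(g)·t_f·u − lc(f)·t_g·v, p))`. -/
noncomputable def oneStepResult (m : MonomialOrder (Fin n)) (x y : LMon n l k) : LMon n l k :=
  let tf := oquot x.1 (lmo m x.2.2)
  let tg := oquot x.1 (lmo m y.2.2)
  let p := mlc m y.2.2 • (monomial tf (1 : k) * x.2.2) - mlc m x.2.2 • (monomial tg (1 : k) * y.2.2)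
  (lmo m p,
    fun i => mlc m y.2.2 • (monomial tf (1 : k) * x.2.1 i)
      - mlc m x.2.2 • (monomial tg (1 : k) * y.2.1 i),
    p)

/-- One-step reduction by `B`. -/
def OneStep (m : MonomialOrder (Fin n)) (B : Set (LMon n l k)) (x z : LMon n l k) : Prop :=
  x.2.2 ≠ 0 ∧ ∃ y ∈ B, y.1 = x.1 ∧
    OSigLT m (osmul (oquot x.1 (lmo m y.2.2)) (vlmo m y.2.1)) (lmSig m x) ∧
    z = oneStepResult m x y

/-- `x` is reduced to `z` by `B`: finitely many one-step reductions, and `z` is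
not reducible by `B`. -/
def ReducedTo (m : MonomialOrder (Fin n)) (B : Set (LMon n l k)) (x z : LMon n l k) : Prop :=
  Relation.ReflTransGen (OneStep m B) x z ∧ ¬ Reducible m z B

end GVW

noncomputable section GVW2

variable {k : Type*} [Field k] {n l : ℕ}

/-- `(u,h) ∈ M` is top-reducible by `G₀ ⊆ M`: if `h = 0`, some `(v,0) ∈ G₀` has
`lm v ∣ lm u`; if `h ≠ 0`, some `(v,g) ∈ G₀` with `g ≠ 0` has `lm g ∣ lm h` and
`(lm h / lm g)·lm v ⪯ₛ lm u`. -/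
def TopReducibleBy (m : MonomialOrder (Fin n))
    (G₀ : Set ((Fin l → MvPolynomial (Fin n) k) × MvPolynomial (Fin n) k))
    (p : (Fin l → MvPolynomial (Fin n) k) × MvPolynomial (Fin n) k) : Prop :=
  (p.2 = 0 → ∃ q ∈ G₀, q.2 = 0 ∧ OSigDvd (vlmo m q.1) (vlmo m p.1)) ∧
  (p.2 ≠ 0 → ∃ q ∈ G₀, q.2 ≠ 0 ∧ OMonDvd (lmo m q.2) (lmo m p.2) ∧
    OSigLE m (osmul (oquot (lmo m p.2) (lmo m q.2)) (vlmo m q.1)) (vlmo m p.1))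

/-- `G₀ ⊆ M` is a strong Gröbner basis of `M`: every `(u,h) ∈ M` is top-reducible by `G₀`. -/
def IsStrongGB (m : MonomialOrder (Fin n)) (F : Fin l → MvPolynomial (Fin n) k)
    (G₀ : Set ((Fin l → MvPolynomial (Fin n) k) × MvPolynomial (Fin n) k)) : Prop :=
  ∀ u h, InM F u h → TopReducibleBy m G₀ (u, h)

/-- `G` is a monomial-oriented strong Gröbner basis of `M`. -/
def IsMoStrongGB (m : MonomialOrder (Fin n)) (F : Fin l → MvPolynomial (Fin n) k)
    (G : Set (LMon n l k)) : Prop :=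
  (∀ u : Fin l → MvPolynomial (Fin n) k, InM F u 0 →
    ∃ y ∈ G, IsSyzygy y ∧ OSigDvd (vlmo m y.2.1) (vlmo m u)) ∧
  (∀ (u : Fin l → MvPolynomial (Fin n) k) (h : MvPolynomial (Fin n) k), InM F u h → h ≠ 0 →
    ∃ y ∈ G, IsPrimitive m y ∧ OMonDvd (lmo m y.2.2) (lmo m h) ∧
      OSigLE m (osmul (oquot (lmo m h) (lmo m y.2.2)) (vlmo m y.2.1)) (vlmo m u))

/-- A pair `(u,h) ∈ M` is covered by `G₀ ⊆ M`: there is `(v,g) ∈ G₀` with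
`lm v ∣ lm u` and `(lm u / lm v)·lm g ≺ₚ lm h` strictly. -/
def PairCovered (m : MonomialOrder (Fin n))
    (G₀ : Set ((Fin l → MvPolynomial (Fin n) k) × MvPolynomial (Fin n) k))
    (p : (Fin l → MvPolynomial (Fin n) k) × MvPolynomial (Fin n) k) : Prop :=
  ∃ q ∈ G₀, OSigDvd (vlmo m q.1) (vlmo m p.1) ∧
    OMonLT m (omul (sigquot (vlmo m p.1) (vlmo m q.1)) (lmo m q.2)) (lmo m p.2)

end GVW2

theorem mdeg_term {k : Type*} [Field k] {n : ℕ} (m : MonomialOrder (Fin n)) {c : k} (hc : c ≠ 0)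
    (t : Fin n →₀ ℕ) {h : MvPolynomial (Fin n) k} (hh : h ≠ 0) :
    mdeg m (c • (MvPolynomial.monomial t (1:k) * h)) = t + mdeg m h := by
  classical
  change m.degree _ = t + m.degree h
  rw [MonomialOrder.degree_smul_of_mem_nonZeroDivisors (mem_nonZeroDivisors_of_ne_zero hc),
    MonomialOrder.degree_mul (by simp) hh, MonomialOrder.degree_monomial]
  simp

theorem term_ne {k : Type*} [Field k] {n : ℕ} {c : k} (hc : c ≠ 0)
    (t : Fin n →₀ ℕ) {h : MvPolynomial (Fin n) k} (hh : h ≠ 0) :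
    c • (MvPolynomial.monomial t (1:k) * h) ≠ 0 :=
  smul_ne_zero hc (mul_ne_zero (by simp) hh)

theorem vlmo_none {k : Type*} [Field k] {n l : ℕ} (m : MonomialOrder (Fin n))
    {u : Fin l → MvPolynomial (Fin n) k} (h : vlmo m u = none) : ∀ i, u i = 0 := by
  by_contra! hc
  unfold vlmo at h
  rw [dif_pos hc] at h
  simp at h

theorem vlmo_some {k : Type*} [Field k] {n l : ℕ} (m : MonomialOrder (Fin n))
    {u : Fin l → MvPolynomial (Fin n) k} {s : ModMon n l} :
    vlmo m u = some s ↔ (u s.2 ≠ 0 ∧ (∀ j < s.2, u j = 0) ∧ mdeg m (u s.2) = s.1) := by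
  classical
  obtain ⟨a, i⟩ := s
  by_cases hc : ∃ i, u i ≠ 0
  · have hne : (Finset.univ.filter fun i => u i ≠ 0).Nonempty := by
      obtain ⟨i, hi⟩ := hc; exact ⟨i, by simp [hi]⟩
    have e : vlmo m u = some (mdeg m (u ((Finset.univ.filter fun i => u i ≠ 0).min' hne)),
        (Finset.univ.filter fun i => u i ≠ 0).min' hne) := by
      unfold vlmo
      rw [dif_pos hc]
      congr!
    have h1 := Finset.min'_mem _ hne
    have h2 : ∀ j, u j ≠ 0 → (Finset.univ.filter fun i => u i ≠ 0).min' hne ≤ j :=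
      fun j hj => Finset.min'_le _ _ (by simp [hj])
    rw [e]
    generalize (Finset.univ.filter fun i => u i ≠ 0).min' hne = i0 at *
    simp only [Finset.mem_filter, Finset.mem_univ, true_and] at h1
    simp only [Option.some.injEq, Prod.mk.injEq]
    constructor
    · rintro ⟨rfl, rfl⟩
      exact ⟨h1, fun j hj => by_contra fun hn => absurd (h2 j hn) (not_le.mpr hj), rfl⟩
    · rintro ⟨g1, g2, g3⟩
      have : i0 = i := le_antisymm (h2 i g1) (not_lt.mp fun hlt => h1 (g2 _ hlt))
      subst this
      exact ⟨g3, rfl⟩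
  · have e : vlmo m u = none := by
      unfold vlmo
      rw [dif_neg hc]
    rw [e]
    push Not at hc
    simp [hc]

theorem vlmo_step {k : Type*} [Field k] {n l : ℕ} (m : MonomialOrder (Fin n))
    (u v : Fin l → MvPolynomial (Fin n) k) (c d : k) (hc : c ≠ 0) (hd : d ≠ 0)
    (tf tg : Fin n →₀ ℕ)
    (hsig : OSigLT m (osmul tg (vlmo m v)) (osmul tf (vlmo m u))) :
    vlmo m (fun i => c • (MvPolynomial.monomial tf (1:k) * u i)
            - d • (MvPolynomial.monomial tg (1:k) * v i)) = osmul tf (vlmo m u) := by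
  rcases hU : vlmo m u with _ | ⟨a, i⟩
  · rw [hU] at hsig
    rcases hV : vlmo m v with _ | s <;> rw [hV] at hsig <;> exact hsig.elim
  rw [hU] at hsig
  obtain ⟨u1, u2, u3⟩ := (vlmo_some m).1 hU
  dsimp only at u1 u2 u3
  change _ = some (tf + a, i)
  rw [vlmo_some]
  dsimp only
  -- simple case: the second vector vanishes up to position `i`
  have key : (∀ j ≤ i, v j = 0) → _ := fun hv => show
      c • (MvPolynomial.monomial tf (1:k) * u i) - d • (MvPolynomial.monomial tg (1:k) * v i) ≠ 0 ∧
      (∀ j < i, c • (MvPolynomial.monomial tf (1:k) * u j)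
        - d • (MvPolynomial.monomial tg (1:k) * v j) = 0) ∧
      mdeg m (c • (MvPolynomial.monomial tf (1:k) * u i)
        - d • (MvPolynomial.monomial tg (1:k) * v i)) = tf + a by
    refine ⟨?_, fun j hj => by simp [u2 j hj, hv j hj.le], ?_⟩
    · rw [hv i le_rfl, mul_zero, smul_zero, sub_zero]
      exact term_ne hc tf u1
    · rw [hv i le_rfl, mul_zero, smul_zero, sub_zero, mdeg_term m hc tf u1, u3]
  rcases hV : vlmo m v with _ | ⟨b, j⟩
  · exact key fun j _ => vlmo_none m hV j
  rw [hV] at hsig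
  obtain ⟨v1, v2, v3⟩ := (vlmo_some m).1 hV
  dsimp only at v1 v2 v3
  rcases (show i < j ∨ (j = i ∧ m.toSyn (tg + b) < m.toSyn (tf + a)) from hsig) with h | ⟨rfl, h⟩
  · exact key fun j' hj' => v2 j' (hj'.trans_lt h)
  · have hA := mdeg_term m hc tf u1
    have hB := mdeg_term m hd tg v1
    rw [u3] at hA
    rw [v3] at hB
    rw [← hA, ← hB] at h
    refine ⟨fun h0 => ?_, fun j' hj' => by simp [u2 j' hj', v2 j' hj'], ?_⟩
    · rw [sub_eq_zero.mp h0] at h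
      exact lt_irrefl _ h
    · rw [← hA]
      exact MonomialOrder.degree_sub_of_lt h

/-- one-step reduction facts. For `(u,f), (v,g) ∈ M` with `f, g ≠ 0`,
a common multiple `μ` of `lm f` and `lm g`, `t_f = μ/lm f`, `t_g = μ/lm g`,
`t_f·lm(u) ≻ₛ t_g·lm(v)`, `p = lc(g)·t_f·f − lc(f)·t_g·g` and
`w = lc(g)·t_f·u − lc(f)·t_g·v`, we have: `lm w = t_f·lm u`, `(w,p) ∈ M`, `lm p ≺ₚ μ`,
and `(lm p, (w,p))` is a labeled monomial, primitive if `p ≠ 0`, a syzygy one if `p = 0`. -/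
theorem statement1 {k : Type*} [Field k] {n l : ℕ}
    (m : MonomialOrder (Fin n)) (F : Fin l → MvPolynomial (Fin n) k)
    (f g : MvPolynomial (Fin n) k) (u v : Fin l → MvPolynomial (Fin n) k)
    (hf : f ≠ 0) (hg : g ≠ 0) (hu : InM F u f) (hv : InM F v g)
    (μ : Fin n →₀ ℕ) (hμf : mdeg m f ≤ μ) (hμg : mdeg m g ≤ μ)
    (tf tg : Fin n →₀ ℕ) (htf : tf = μ - mdeg m f) (htg : tg = μ - mdeg m g)
    (hsig : OSigLT m (osmul tg (vlmo m v)) (osmul tf (vlmo m u)))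
    (p : MvPolynomial (Fin n) k) (w : Fin l → MvPolynomial (Fin n) k)
    (hp : p = mlc m g • (MvPolynomial.monomial tf (1:k) * f)
            - mlc m f • (MvPolynomial.monomial tg (1:k) * g))
    (hw : w = fun i => mlc m g • (MvPolynomial.monomial tf (1:k) * u i)
            - mlc m f • (MvPolynomial.monomial tg (1:k) * v i)) :
    vlmo m w = osmul tf (vlmo m u) ∧ InM F w p ∧ OMonLT m (lmo m p) (some μ) ∧
    IsLabeled m F (lmo m p, w, p) ∧
    (p ≠ 0 → IsPrimitive m ((lmo m p, w, p) : LMon n l k)) ∧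
    (p = 0 → IsSyzygy ((lmo m p, w, p) : LMon n l k)) := by
  have hcf : mlc m f ≠ 0 := MonomialOrder.coeff_degree_ne_zero_iff.mpr hf
  have hcg : mlc m g ≠ 0 := MonomialOrder.coeff_degree_ne_zero_iff.mpr hg
  have h1 : vlmo m w = osmul tf (vlmo m u) := by
    rw [hw]; exact vlmo_step m u v _ _ hcg hcf tf tg hsig
  have h2 : InM F w p := by
    unfold InM at *
    rw [hw, hp, ← hu, ← hv]
    simp only [sub_mul, Finset.sum_sub_distrib, Finset.mul_sum, Finset.smul_sum, smul_mul_assoc,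
      mul_assoc]
  have ef : tf + mdeg m f = μ := by rw [htf]; exact tsub_add_cancel_of_le hμf
  have eg : tg + mdeg m g = μ := by rw [htg]; exact tsub_add_cancel_of_le hμg
  have hpμ : p.coeff μ = 0 := by
    rw [hp, MvPolynomial.coeff_sub, MvPolynomial.coeff_smul, MvPolynomial.coeff_smul]
    conv_lhs => rw [← ef, MvPolynomial.coeff_monomial_mul, ef, ← eg,
      MvPolynomial.coeff_monomial_mul]
    simp only [mlc, smul_eq_mul]
    ring
  have h3 : OMonLT m (lmo m p) (some μ) := by
    unfold lmo
    split_ifs with h0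
    · trivial
    · change m.toSyn (mdeg m p) < m.toSyn μ
      refine lt_of_le_of_ne ?_ fun he => ?_
      · rw [hp]
        refine le_trans (MonomialOrder.degree_sub_le (m := m)) ?_
        change m.toSyn (mdeg m _) ⊔ m.toSyn (mdeg m _) ≤ _
        rw [mdeg_term m hcg tf hf, mdeg_term m hcf tg hg, ef, eg, sup_idem]
      · have he' := m.toSyn.injective he
        rw [← he'] at hpμ
        exact h0 (MonomialOrder.coeff_degree_eq_zero_iff.mp hpμ)
  refine ⟨h1, h2, h3, ⟨h2, ?_, ?_⟩, fun h => ⟨h, rfl⟩, fun h => ⟨?_, h⟩⟩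
  · rintro ⟨hw0, -⟩
    dsimp only at hw0
    rcases hU : vlmo m u with _ | s
    · rw [hU] at hsig
      rcases hV : vlmo m v with _ | s <;> rw [hV] at hsig <;> exact hsig.elim
    · rw [hU] at h1
      exact ((vlmo_some m).1 h1).1 (by rw [hw0]; rfl)
  · dsimp only
    rcases lmo m p with _ | s
    · rfl
    · exact le_refl s
  · simp [lmo, h]
end

section
/- (LCM Criterion) Let G be a set of labeled monomials, (lm(h), (u, h)) a primitive labeled monomial, and t ∈ Mon(R). Suppose there exists (m, (v, g)) ∈ G with m = t·lm(h) such that: (1) t·(lm(h), (u, h)) is not the J-pair of (lm(h), (u, h)) and (lm(g), (v, g)) but is a multiple of this J-pair, i.e., m ≠ lcm(lm(h), lm(g)) and t·lm(u) ≻_s t_g·lm(v) where t_g = m/lm(g); and (2) the J-pair of (lm(h), (u, h)) and (lm(g), (v, g)) is covered by G. Then (t·lm(h), (u, h)) is covered by G. -/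
/- Common setup: monomials, leading monomials with the `lm 0 = 0` convention
   (encoded via `Option`, `none` being the zero monomial), module monomials
   (signatures), the module `M = {(u, h) | u ⬝ f = h}`, labeled monomials,
   cover, reducibility, etc., following the paper's conventions. -/

open MvPolynomial

/-- LCM Criterion. Let `G` be a set of labeled monomials,
`(lm h,(u,h))` a primitive labeled monomial and `t` a monomial. Suppose there is
`(m',(v,g)) ∈ G` with `m' = t·lm h` such that (1) `t·lm h ≠ lcm(lm h, lm g)` and
`t·lm u ≻ₛ t_g·lm v` where `t_g = m'/lm g`, and (2) the J-pair
`(lcm(lm h, lm g), (u,h))` is covered by `G`. Then `(t·lm h,(u,h))` is covered by `G`. -/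
theorem statement8 {k : Type*} [Field k] {n l : ℕ}
    (m : MonomialOrder (Fin n)) (F : Fin l → MvPolynomial (Fin n) k)
    (G : Set (LMon n l k)) (hlab : ∀ z ∈ G, IsLabeled m F z)
    (u : Fin l → MvPolynomial (Fin n) k) (h : MvPolynomial (Fin n) k)
    (hh : h ≠ 0) (hprim : IsLabeled m F ((lmo m h, u, h) : LMon n l k))
    (t : Fin n →₀ ℕ) (v : Fin l → MvPolynomial (Fin n) k) (g : MvPolynomial (Fin n) k)
    (hyG : ((some (t + mdeg m h), v, g) : LMon n l k) ∈ G)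
    (h1a : t + mdeg m h ≠ mdeg m h ⊔ mdeg m g)
    (h1b : OSigLT m (osmul ((t + mdeg m h) - mdeg m g) (vlmo m v)) (osmul t (vlmo m u)))
    (h2 : Covered m ((some (mdeg m h ⊔ mdeg m g), u, h) : LMon n l k) G) :
    Covered m ((some (t + mdeg m h), u, h) : LMon n l k) G := by
  obtain ⟨_, _, hdvd⟩ := hlab _ hyG
  have hle : mdeg m g ≤ t + mdeg m h := by
    by_cases hg : g = 0
    · simp [lmo, hg, OMonDvd] at hdvd
    · simpa [lmo, hg, OMonDvd] using hdvd
  have hsup : mdeg m h ⊔ mdeg m g ≤ t + mdeg m h := sup_le le_add_self hle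
  obtain ⟨d, hd⟩ := exists_add_of_le hsup
  obtain ⟨s, hs⟩ := exists_add_of_le (le_sup_left : mdeg m h ≤ mdeg m h ⊔ mdeg m g)
  have ht : t = d + s := by
    rw [hs] at hd
    have : mdeg m h + t = mdeg m h + (d + s) := by
      rw [add_comm, hd]; abel
    exact add_left_cancel this
  obtain ⟨y, hy, hy1, hy2⟩ := h2
  refine ⟨y, hy, ?_⟩
  rw [hd]
  have e1 : lmSig m ((some (mdeg m h ⊔ mdeg m g), u, h) : LMon n l k) = osmul s (vlmo m u) := by
    simp [lmSig, lmo, hh, oquot, hs]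
  have e2 : lmSig m ((some (mdeg m h ⊔ mdeg m g + d), u, h) : LMon n l k)
      = osmul (d + s) (vlmo m u) := by
    rw [← hd, ← ht]
    simp [lmSig, lmo, hh, oquot]
  rw [e1] at hy1 hy2
  rw [e2]
  cases hu : vlmo m u with
  | none =>
    rw [hu] at h1b
    cases hv : vlmo m v <;> simp [hv, osmul, OSigLT] at h1b
  | some a =>
    rw [hu] at hy1 hy2
    cases hv : vlmo m y.2.1 with
    | none => simp [hv, osmul, OSigDvd] at hy1
    | some b =>
      rw [hv] at hy1 hy2
      simp only [osmul, Option.map_some, OSigDvd] at hy1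
      obtain ⟨hb, hba⟩ := hy1
      obtain ⟨c, hc⟩ := exists_add_of_le hba
      have hc2 : d + s + a.1 = b.1 + (d + c) := by
        rw [add_assoc, hc]; abel
      refine ⟨⟨hb, ?_⟩, ?_⟩
      · change b.1 ≤ d + s + a.1
        rw [hc2]; exact le_self_add
      · cases hg : lmo m y.2.2 with
        | none => simp [omul, OMonLT]
        | some e =>
          rw [hg] at hy2
          simp only [osmul, Option.map_some, omul, OMonLT, sigquot] at hy2 ⊢
          rw [hc2, add_tsub_cancel_left]
          rw [hc, add_tsub_cancel_left] at hy2
          rw [add_assoc, add_comm (mdeg m h ⊔ mdeg m g) d, map_add, map_add m.toSyn d]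
          exact add_lt_add_right hy2 _
end

section
/- (Principal Syzygy Criterion) Let (m, (u, h)) be a labeled monomial with m ≠ 0, lm(u) = x^α e_i, and t_h = m/lm(h). Suppose there exists a labeled monomial (t_h·x^α, (v, g)) with lm(v) = x^β e_j and i > j (so that e_i ≻_s e_j). Then (g·e_i − f_i·v)·f = 0, so (0, (g·e_i − f_i·v, 0)) is a syzygy labeled monomial; moreover lm(g·e_i − f_i·v) = lm(g)·e_i divides t_h·lm(u), and consequently (m, (u, h)) is covered by {(0, (g·e_i − f_i·v, 0))}. -/
/- Common setup: monomials, leading monomials with the `lm 0 = 0` convention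
   (encoded via `Option`, `none` being the zero monomial), module monomials
   (signatures), the module `M = {(u, h) | u ⬝ f = h}`, labeled monomials,
   cover, reducibility, etc., following the paper's conventions. -/

open MvPolynomial

theorem vlmo_eq_some_aux {k : Type*} [Field k] {n l : ℕ} (m : MonomialOrder (Fin n))
    (u : Fin l → MvPolynomial (Fin n) k) (i : Fin l) (hi : u i ≠ 0)
    (hlt : ∀ i' < i, u i' = 0) : vlmo m u = some (mdeg m (u i), i) := by
  classical
  unfold vlmo
  rw [dif_pos ⟨i, hi⟩]
  dsimp only
  generalize_proofs hne
  have key : Finset.min' _ hne = i := by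
    apply le_antisymm
    · exact Finset.min'_le _ _ (by simp [hi])
    · apply Finset.le_min'
      intro y hy
      by_contra hc
      simp only [Finset.mem_filter, Finset.mem_univ, true_and] at hy
      exact hy (hlt y (not_le.mp hc))
  rw [key]

theorem vlmo_lt_aux {k : Type*} [Field k] {n l : ℕ} (m : MonomialOrder (Fin n))
    (u : Fin l → MvPolynomial (Fin n) k) (β : Fin n →₀ ℕ) (j : Fin l)
    (hv : vlmo m u = some (β, j)) (i : Fin l) (hij : i < j) : u i = 0 := by
  classical
  by_contra hi
  unfold vlmo at hv
  rw [dif_pos ⟨i, hi⟩] at hv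
  simp only [Option.some.injEq, Prod.mk.injEq] at hv
  have h2 := hv.2
  rw [← h2] at hij
  exact absurd hij (not_lt.mpr (Finset.min'_le _ _ (by simp [hi])))

/-- Principal Syzygy Criterion. Let `(μ,(u,h))` be a labeled monomial
with `μ ≠ 0`, `lm u = x^α e_i`, `t_h = μ/lm h`. Suppose `(t_h·x^α,(v,g))` is a labeled
monomial with `lm v = x^β e_j` and `e_i ≻ₛ e_j`. Then `(g·e_i − f_i·v)·f = 0`, so
`(0,(g·e_i − f_i·v, 0))` is a syzygy labeled monomial; `lm(g·e_i − f_i·v) = lm(g)·e_i`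
divides `t_h·lm u`, and `(μ,(u,h))` is covered by `{(0,(g·e_i − f_i·v, 0))}`. -/
theorem statement11 {k : Type*} [Field k] {n l : ℕ}
    (m : MonomialOrder (Fin n)) (F : Fin l → MvPolynomial (Fin n) k)
    (μ : Option (Fin n →₀ ℕ)) (u : Fin l → MvPolynomial (Fin n) k)
    (h : MvPolynomial (Fin n) k)
    (hx : IsLabeled m F ((μ, u, h) : LMon n l k)) (hμ : μ ≠ none)
    (α : Fin n →₀ ℕ) (i : Fin l) (hu : vlmo m u = some (α, i))
    (v : Fin l → MvPolynomial (Fin n) k) (g : MvPolynomial (Fin n) k)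
    (hy : IsLabeled m F ((some (oquot μ (lmo m h) + α), v, g) : LMon n l k))
    (β : Fin n →₀ ℕ) (j : Fin l) (hv : vlmo m v = some (β, j))
    (hij : SigLT m ((0 : Fin n →₀ ℕ), j) ((0 : Fin n →₀ ℕ), i)) :
    InM F (Pi.single i g - F i • v) 0 ∧
    IsSyzygy ((none, Pi.single i g - F i • v, 0) : LMon n l k) ∧
    IsLabeled m F ((none, Pi.single i g - F i • v, 0) : LMon n l k) ∧
    vlmo m (Pi.single i g - F i • v) = some (mdeg m g, i) ∧
    OSigDvd (some ((mdeg m g, i) : ModMon n l)) (osmul (oquot μ (lmo m h)) (vlmo m u)) ∧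
    Covered m ((μ, u, h) : LMon n l k) {(none, Pi.single i g - F i • v, 0)} := by
  have hlt : i < j := by
    rcases hij with h1 | ⟨_, h2⟩
    · exact h1
    · exact absurd h2 (lt_irrefl _)
  obtain ⟨hyM, -, hyd⟩ := hy
  simp only [InM] at hyM
  have hg : g ≠ 0 := by
    rintro rfl
    simp [lmo, OMonDvd] at hyd
  have hle : mdeg m g ≤ oquot μ (lmo m h) + α := by
    simpa [lmo, hg, OMonDvd] using hyd
  have hv0 : ∀ i' ≤ i, v i' = 0 := fun i' hi' =>
    vlmo_lt_aux m v β j hv i' (lt_of_le_of_lt hi' hlt)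
  have hwi : (Pi.single i g - F i • v : Fin l → MvPolynomial (Fin n) k) i = g := by
    simp [hv0 i le_rfl]
  have hvl : vlmo m (Pi.single i g - F i • v) = some (mdeg m g, i) := by
    have := vlmo_eq_some_aux m (Pi.single i g - F i • v) i (by rw [hwi]; exact hg)
      (fun i' hi' => by simp [hv0 i' hi'.le, Pi.single_eq_of_ne hi'.ne])
    rwa [hwi] at this
  have hM : InM F (Pi.single i g - F i • v) 0 := by
    have h1 : ∑ x, (Pi.single i g : Fin l → MvPolynomial (Fin n) k) x * F x = g * F i := by
      rw [Finset.sum_eq_single i]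
      · simp
      · intro b _ hb
        simp [Pi.single_eq_of_ne hb]
      · simp
    simp only [InM, Pi.sub_apply, Pi.smul_apply, smul_eq_mul, sub_mul, Finset.sum_sub_distrib,
      mul_assoc, ← Finset.mul_sum, h1, hyM]
    ring
  have hdvd : OSigDvd (some ((mdeg m g, i) : ModMon n l))
      (osmul (oquot μ (lmo m h)) (vlmo m u)) := by
    rw [hu]
    exact ⟨rfl, hle⟩
  refine ⟨hM, ⟨rfl, rfl⟩, ⟨hM, ?_, ?_⟩, hvl, hdvd, ?_⟩
  · rintro ⟨h0, -⟩
    apply hg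
    rw [← hwi]
    exact congrFun h0 i
  · simp [lmo, OMonDvd]
  · refine ⟨_, Set.mem_singleton _, ?_, ?_⟩
    · simp only [hvl, lmSig]
      exact hdvd
    · obtain ⟨a, rfl⟩ := Option.ne_none_iff_exists'.mp hμ
      simp [lmo, omul, OMonLT]
end
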